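/- arXiv:1404.2895 — 2 statements merged into one kernel-verified Lean document; each statement's English description precedes it below -/
import Mathlib

section
/- There exist constants C > 0 and Δ₀ such that every triangle-free (simple) graph G with maximum degree at most Δ, where Δ ≥ Δ₀, satisfies χ(G) ≤ C·Δ/log Δ. -/
section Counting

open Finset

variable {V : Type*} [Fintype V] (G : SimpleGraph V) [DecidableRel G.Adj] {q : ℕ}

/-- The colors that do not appear on the neighbors of `u`. -/
def availableColors (f : V → Option (Fin q)) (u : V) : Finset (Fin q) :=
  {c | ∀ w, G.Adj u w → f w ≠ some c}

variable {G} in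
theorem mem_availableColors {f : V → Option (Fin q)} {u : V} {c : Fin q} :
    c ∈ availableColors G f u ↔ ∀ w, G.Adj u w → f w ≠ some c := by
  simp [availableColors]

variable [DecidableEq V]

/-- The proper colorings with colors in `Fin q` of the subgraph of `G` induced on `S`, encoded as
functions on all vertices that take the value `none` exactly outside `S`. -/
def partialColorings (q : ℕ) (S : Finset V) : Finset (V → Option (Fin q)) :=
  {f | (∀ v, (f v).isSome ↔ v ∈ S) ∧ ∀ u v, G.Adj u v → ∀ c, f u = some c → f v ≠ some c}

variable {G}

theorem mem_partialColorings {S : Finset V} {f : V → Option (Fin q)} :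
    f ∈ partialColorings G q S ↔ (∀ v, (f v).isSome ↔ v ∈ S) ∧
      ∀ u v, G.Adj u v → ∀ c, f u = some c → f v ≠ some c := by
  simp [partialColorings]

theorem eq_none_of_mem_partialColorings {S : Finset V} {f : V → Option (Fin q)}
    (hf : f ∈ partialColorings G q S) {v : V} (hv : v ∉ S) : f v = none := by
  have := (mem_partialColorings.1 hf).1 v
  simpa [hv] using this

theorem exists_mem_availableColors {S : Finset V} {f : V → Option (Fin q)}
    (hf : f ∈ partialColorings G q S) {v : V} (hv : v ∈ S) :
    ∃ c ∈ availableColors G f v, f v = some c := by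
  obtain ⟨c, hc⟩ := Option.isSome_iff_exists.1 (((mem_partialColorings.1 hf).1 v).2 hv)
  exact ⟨c, mem_availableColors.2 fun w hw => (mem_partialColorings.1 hf).2 v w hw c hc, hc⟩

theorem sum_card_availableColors_le {S : Finset V} {v : V} (hv : v ∉ S) :
    ∑ f ∈ partialColorings G q S, #(availableColors G f v) ≤
      #(partialColorings G q (insert v S)) := by
  rw [← card_sigma]
  refine card_le_card_of_injOn (fun p => Function.update p.1 v (some p.2)) ?_ ?_
  · rintro ⟨f, c⟩ hp
    simp only [coe_sigma, Set.mem_sigma_iff, mem_coe] at hp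
    obtain ⟨hf, hc⟩ := hp
    rw [mem_partialColorings] at hf
    rw [mem_availableColors] at hc
    simp only [mem_coe, mem_partialColorings]
    refine ⟨fun u => ?_, fun u w huw d hu hw => ?_⟩
    · by_cases h : u = v
      · simp [h]
      · simp [h, hf.1 u]
    · by_cases h : u = v
      · subst h
        have hwu : w ≠ u := huw.ne'
        simp only [Function.update_self, Option.some.injEq] at hu
        rw [Function.update_of_ne hwu] at hw
        exact hc w huw (hu ▸ hw)
      · rw [Function.update_of_ne h] at hu
        by_cases h' : w = v
        · subst h'
          simp only [Function.update_self, Option.some.injEq] at hw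
          exact hc u huw.symm (hw ▸ hu)
        · rw [Function.update_of_ne h'] at hw
          exact hf.2 u w huw d hu hw
  · rintro ⟨f, c⟩ hf ⟨g, d⟩ hg h
    simp only [coe_sigma, Set.mem_sigma_iff, mem_coe] at hf hg
    have hcd : c = d := by simpa using congrFun h v
    subst hcd
    suffices f = g by subst this; rfl
    funext u
    by_cases hu : u = v
    · rw [hu, eq_none_of_mem_partialColorings hf.1 hv, eq_none_of_mem_partialColorings hg.1 hv]
    · simpa [hu] using congrFun h u

theorem card_filter_card_availableColors_le_one {S : Finset V} {u : V} (hu : u ∈ S) :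
    #{f ∈ partialColorings G q S | #(availableColors G f u) ≤ 1} ≤
      #(partialColorings G q (S.erase u)) := by
  refine card_le_card_of_injOn (fun f => Function.update f u none) ?_ ?_
  · intro f hf
    simp only [coe_filter, Set.mem_ofPred_eq, mem_partialColorings] at hf
    obtain ⟨⟨h1, h2⟩, -⟩ := hf
    simp only [mem_coe, mem_partialColorings]
    refine ⟨fun w => ?_, fun x w hxw d hx hw => ?_⟩
    · by_cases h : w = u
      · simp [h]
      · simp [h, h1 w]
    · have hxu : x ≠ u := by rintro rfl; simp at hx
      have hwu : w ≠ u := by rintro rfl; simp at hw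
      rw [Function.update_of_ne hxu] at hx
      rw [Function.update_of_ne hwu] at hw
      exact h2 x w hxw d hx hw
  · intro f hf g hg h
    simp only [coe_filter, Set.mem_ofPred_eq] at hf hg
    have hne : ∀ w, w ≠ u → f w = g w := fun w hw => by simpa [hw] using congrFun h w
    have hav : availableColors G f u = availableColors G g u := by
      ext c
      simp only [mem_availableColors]
      exact forall₂_congr fun w hw => by rw [hne w hw.ne']
    obtain ⟨c, hc, hfc⟩ := exists_mem_availableColors hf.1 hu
    obtain ⟨d, hd, hgd⟩ := exists_mem_availableColors hg.1 hu
    have hcd : c = d := card_le_one.1 hf.2 c hc d (hav ▸ hd)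
    funext w
    by_cases hw : w = u
    · rw [hw, hfc, hgd, hcd]
    · exact hne w hw

theorem exp_neg_two_div_le {m : ℝ} (hm : 2 ≤ m) : Real.exp (-(2 / m)) ≤ (m - 1) / m := by
  have h1 : 1 + 2 / m ≤ Real.exp (2 / m) := by linarith [Real.add_one_le_exp (2 / m)]
  rw [Real.exp_neg]
  have hm0 : 0 < m := by linarith
  have h2 : (m - 1) / m * (1 + 2 / m) ≥ 1 := by
    have : (m - 1) / m * (1 + 2 / m) = 1 + (m - 2) / m ^ 2 := by field_simp; ring
    rw [this]
    have : 0 ≤ (m - 2) / m ^ 2 := div_nonneg (by linarith) (by positivity)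
    linarith
  rw [inv_le_iff_one_le_mul₀ (Real.exp_pos _)]
  have h3 : 0 ≤ (m - 1) / m := div_nonneg (by linarith) hm0.le
  nlinarith

/-- Jensen's inequality for `x ↦ exp (-x)`, with a bound on the sum. -/
theorem card_mul_exp_neg_le_sum {ι : Type*} (s : Finset ι) (x : ι → ℝ) (a : ℝ)
    (h : ∑ i ∈ s, x i ≤ #s * a) : #s * Real.exp (-a) ≤ ∑ i ∈ s, Real.exp (-x i) := by
  have key : ∀ i ∈ s, Real.exp (-a) * (1 + a - x i) ≤ Real.exp (-x i) := fun i _ => by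
    have h1 := Real.add_one_le_exp (a - x i)
    have h2 : Real.exp (-x i) = Real.exp (-a) * Real.exp (a - x i) := by
      rw [← Real.exp_add]; congr 1; ring
    rw [h2]
    exact mul_le_mul_of_nonneg_left (by linarith) (Real.exp_pos _).le
  refine le_trans ?_ (sum_le_sum key)
  rw [← mul_sum, sum_sub_distrib, sum_const, nsmul_eq_mul]
  nlinarith [Real.exp_pos (-a)]

/-- If each `u ∈ N` picks a color uniformly from its list `L u`, then the expected number of
unused colors is at least `q * exp (-2 * D / q)` minus the number of lists with only one color. -/
theorem prod_card_mul_le_sum_prod_card_erase {ι : Type*} (N : Finset ι)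
    (L : ι → Finset (Fin q)) (hL : ∀ u ∈ N, (L u).Nonempty) (D : ℝ) (hD : #N ≤ D)
    (hq : 0 < q) :
    (∏ u ∈ N, (#(L u) : ℝ)) * (q * Real.exp (-(2 * D / q)) - #{u ∈ N | #(L u) ≤ 1}) ≤
      ∑ c, ∏ u ∈ N, (#((L u).erase c) : ℝ) := by
  set x : Fin q → ℝ := fun c => ∑ u ∈ N, if c ∈ L u then 2 / (#(L u) : ℝ) else 0 with hx
  set B := {u ∈ N | #(L u) ≤ 1} with hB
  have hpos : ∀ u ∈ N, (0 : ℝ) < #(L u) := fun u hu => by exact_mod_cast (hL u hu).card_pos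
  have hW : 0 ≤ ∏ u ∈ N, (#(L u) : ℝ) := prod_nonneg fun u hu => (hpos u hu).le
  have hcolor : ∀ c, (∏ u ∈ N, (#(L u) : ℝ)) *
      (Real.exp (-x c) - ∑ u ∈ B, if c ∈ L u then (1 : ℝ) else 0) ≤
      ∏ u ∈ N, (#((L u).erase c) : ℝ) := by
    intro c
    by_cases h : ∃ u ∈ B, c ∈ L u
    · obtain ⟨u, hu, hc⟩ := h
      refine le_trans ?_ (prod_nonneg fun u _ => Nat.cast_nonneg _)
      refine mul_nonpos_of_nonneg_of_nonpos hW ?_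
      have h1 : (1 : ℝ) ≤ ∑ u ∈ B, if c ∈ L u then (1 : ℝ) else 0 := by
        have := single_le_sum (f := fun u => if c ∈ L u then (1 : ℝ) else 0)
          (fun i _ => by positivity) hu
        simpa [hc] using this
      have h2 : Real.exp (-x c) ≤ 1 := Real.exp_le_one_iff.2 <| neg_nonpos.2 <|
        sum_nonneg fun u _ => by positivity
      linarith
    · push Not at h
      rw [sum_eq_zero fun u hu => if_neg (h u hu), sub_zero, hx, ← sum_neg_distrib,
        Real.exp_sum, ← prod_mul_distrib]
      refine prod_le_prod (fun u _ => by positivity) fun u hu => ?_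
      by_cases hc : c ∈ L u
      · have h2 : 2 ≤ #(L u) := by
          by_contra hlt
          exact h u (by rw [hB, mem_filter]; exact ⟨hu, by omega⟩) hc
        have h3 := exp_neg_two_div_le (m := #(L u)) (by exact_mod_cast h2)
        rw [if_pos hc, card_erase_of_mem hc, Nat.cast_sub (by omega), Nat.cast_one]
        calc _ ≤ (#(L u) : ℝ) * ((#(L u) - 1) / #(L u)) := by gcongr
          _ = _ := mul_div_cancel₀ _ (hpos u hu).ne'
      · simp [hc, erase_eq_of_notMem]
  refine le_trans ?_ (sum_le_sum fun c _ => hcolor c)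
  rw [← mul_sum, sum_sub_distrib]
  refine mul_le_mul_of_nonneg_left ?_ hW
  have hbad : ∑ c, ∑ u ∈ B, (if c ∈ L u then (1 : ℝ) else 0) ≤ #B := by
    rw [sum_comm, card_eq_sum_ones, Nat.cast_sum]
    refine sum_le_sum fun u hu => ?_
    rw [sum_boole, filter_univ_mem]
    exact_mod_cast (mem_filter.1 hu).2
  have hsum : ∑ c, x c ≤ #(univ : Finset (Fin q)) * (2 * D / q) := by
    have : ∑ c, x c = ∑ u ∈ N, 2 := by
      rw [hx, sum_comm]
      refine sum_congr rfl fun u hu => ?_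
      rw [← sum_filter, sum_const, nsmul_eq_mul, filter_univ_mem]
      exact mul_div_cancel₀ _ (hpos u hu).ne'
    rw [this, sum_const, nsmul_eq_mul, card_univ, Fintype.card_fin,
      mul_div_cancel₀ _ (by positivity)]
    linarith
  have := card_mul_exp_neg_le_sum univ x _ hsum
  rw [card_univ, Fintype.card_fin] at this
  linarith

/-- Replacing the colors of the neighbors of `v` by arbitrary available ones gives all proper
colorings that agree with `f` outside the neighborhood of `v`. -/
theorem filter_agree_eq_piFinset (hG : G.CliqueFree 3) {S : Finset V} {f : V → Option (Fin q)}
    (hf : f ∈ partialColorings G q S) (v : V) :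
    {g ∈ partialColorings G q S | ∀ u, ¬ G.Adj v u → g u = f u} =
      Fintype.piFinset fun u => if u ∈ S ∧ G.Adj v u then
        (availableColors G f u).map Function.Embedding.some else {f u} := by
  have hind : ∀ {u w}, G.Adj v u → G.Adj u w → ¬ G.Adj v w := fun hu huw hw =>
    hG _ (SimpleGraph.is3Clique_triple_iff.2 ⟨hu, hw, huw⟩)
  obtain ⟨hf1, hf2⟩ := mem_partialColorings.1 hf
  ext g
  simp only [mem_filter, Fintype.mem_piFinset, mem_partialColorings]
  constructor
  · rintro ⟨⟨hg1, hg2⟩, hgf⟩ u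
    split_ifs with hu
    · obtain ⟨c, hc⟩ := Option.isSome_iff_exists.1 ((hg1 u).2 hu.1)
      refine mem_map.2 ⟨c, mem_availableColors.2 fun w hw => ?_, hc.symm⟩
      rw [← hgf w (hind hu.2 hw)]
      exact hg2 u w hw c hc
    · rw [mem_singleton]
      by_cases hvu : G.Adj v u
      · have huS : u ∉ S := fun h => hu ⟨h, hvu⟩
        rw [eq_none_of_mem_partialColorings (mem_partialColorings.2 ⟨hg1, hg2⟩) huS,
          eq_none_of_mem_partialColorings hf huS]
      · exact hgf u hvu
  · intro h
    have hout : ∀ u, ¬ (u ∈ S ∧ G.Adj v u) → g u = f u := fun u hu => by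
      simpa [hu] using h u
    have hin : ∀ u, u ∈ S → G.Adj v u → ∃ c ∈ availableColors G f u, g u = some c :=
      fun u hu hvu => by
        have := h u
        rw [if_pos ⟨hu, hvu⟩, mem_map] at this
        obtain ⟨c, hc, hcu⟩ := this
        exact ⟨c, hc, hcu.symm⟩
    have havoid : ∀ u w, u ∈ S → G.Adj v u → G.Adj u w → ∀ c, g u = some c → g w ≠ some c := by
      intro u w hu hvu huw c hc
      obtain ⟨d, hd, hgd⟩ := hin u hu hvu
      have hcd : d = c := by simpa [hgd] using hc
      rw [hout w fun hw => hind hvu huw hw.2, ← hcd]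
      exact mem_availableColors.1 hd w huw
    refine ⟨⟨fun u => ?_, fun u w huw c hu hw => ?_⟩, fun u hu => hout u fun h => hu h.2⟩
    · by_cases hu : u ∈ S ∧ G.Adj v u
      · obtain ⟨c, -, hc⟩ := hin u hu.1 hu.2
        simp [hc, hu.1]
      · rw [hout u hu, hf1 u]
    · by_cases h1 : u ∈ S ∧ G.Adj v u
      · exact havoid u w h1.1 h1.2 huw c hu hw
      · by_cases h2 : w ∈ S ∧ G.Adj v w
        · exact havoid w u h2.1 h2.2 huw.symm c hw hu
        · rw [hout u h1] at hu
          rw [hout w h2] at hw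
          exact hf2 u w huw c hu hw

theorem card_piFinset_ite_map_some (S : Finset V) (v : V) (f : V → Option (Fin q))
    (L : V → Finset (Fin q)) :
    #(Fintype.piFinset fun u => if u ∈ S ∧ G.Adj v u then
        (L u).map Function.Embedding.some else {f u}) = ∏ u ∈ S with G.Adj v u, #(L u) := by
  rw [Fintype.card_piFinset, ← prod_subset (subset_univ {u ∈ S | G.Adj v u})]
  · refine prod_congr rfl fun u hu => ?_
    rw [if_pos (mem_filter.1 hu), card_map]
  · intro u _ hu
    rw [if_neg fun h => hu (mem_filter.2 h), card_singleton]

theorem mul_sum_agree_le (hG : G.CliqueFree 3) {S : Finset V} {f : V → Option (Fin q)}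
    (hf : f ∈ partialColorings G q S) (v : V) (hq : 0 < q) {D : ℝ} (hD : G.degree v ≤ D) :
    ∑ g ∈ partialColorings G q S with ∀ u, ¬ G.Adj v u → g u = f u,
        (q * Real.exp (-(2 * D / q)) -
          #{u ∈ S | G.Adj v u ∧ #(availableColors G g u) ≤ 1}) ≤
      ∑ g ∈ partialColorings G q S with ∀ u, ¬ G.Adj v u → g u = f u,
        (#(availableColors G g v) : ℝ) := by
  have hind : ∀ {u w}, G.Adj v u → G.Adj u w → ¬ G.Adj v w := fun hu huw hw =>
    hG _ (SimpleGraph.is3Clique_triple_iff.2 ⟨hu, hw, huw⟩)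
  set N := {u ∈ S | G.Adj v u} with hN
  set F := {g ∈ partialColorings G q S | ∀ u, ¬ G.Adj v u → g u = f u} with hF
  have hFpi := filter_agree_eq_piFinset hG hf v
  have hcard : #F = ∏ u ∈ N, #(availableColors G f u) := by
    rw [hF, hFpi, card_piFinset_ite_map_some]
  have hbad : ∀ g ∈ F, #{u ∈ S | G.Adj v u ∧ #(availableColors G g u) ≤ 1} =
      #{u ∈ N | #(availableColors G f u) ≤ 1} := by
    intro g hg
    rw [hN, filter_filter]
    congr 1
    refine filter_congr fun u _ => and_congr_right fun hvu => ?_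
    have : availableColors G g u = availableColors G f u := by
      ext c
      simp only [mem_availableColors]
      exact forall₂_congr fun w hw => by rw [(mem_filter.1 hg).2 w (hind hvu hw)]
    rw [this]
  have hcolor : ∀ c, #{g ∈ F | c ∈ availableColors G g v} =
      ∏ u ∈ N, #((availableColors G f u).erase c) := by
    intro c
    rw [hN, ← card_piFinset_ite_map_some S v f fun u => (availableColors G f u).erase c]
    congr 1
    ext g
    rw [mem_filter, hF, hFpi, Fintype.mem_piFinset, Fintype.mem_piFinset, mem_availableColors,
      ← forall_and]
    refine forall_congr' fun u => ?_
    by_cases hu : u ∈ S ∧ G.Adj v u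
    · simp only [if_pos hu, mem_map, mem_erase, Function.Embedding.some_apply]
      constructor
      · rintro ⟨⟨d, hd, hdu⟩, h⟩
        refine ⟨d, ⟨?_, hd⟩, hdu⟩
        rintro rfl
        exact h hu.2 hdu.symm
      · rintro ⟨d, ⟨hdc, hd⟩, hdu⟩
        refine ⟨⟨d, hd, hdu⟩, fun _ h => hdc ?_⟩
        simpa [← hdu] using h
    · simp only [if_neg hu, mem_singleton, and_iff_left_iff_imp]
      intro hgu hvu
      rw [hgu, eq_none_of_mem_partialColorings hf fun h => hu ⟨h, hvu⟩]
      simp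
  have hswap : ∑ g ∈ F, (#(availableColors G g v) : ℝ) =
      ∑ c, ∏ u ∈ N, (#((availableColors G f u).erase c) : ℝ) := by
    have h1 : ∑ g ∈ F, #(availableColors G g v) = ∑ c, #{g ∈ F | c ∈ availableColors G g v} := by
      have := sum_card_bipartiteAbove_eq_sum_card_bipartiteBelow (s := F) (t := univ)
        fun g c => c ∈ availableColors G g v
      simpa [bipartiteAbove, bipartiteBelow] using this
    simp only [hcolor] at h1
    exact_mod_cast h1
  have hND : (#N : ℝ) ≤ D := by
    refine le_trans (Nat.cast_le.2 ?_) hD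
    rw [← G.card_neighborFinset_eq_degree]
    exact card_le_card fun u hu => (G.mem_neighborFinset v u).2 (mem_filter.1 hu).2
  rw [hswap, sum_congr rfl fun g hg => by rw [hbad g hg], sum_const, nsmul_eq_mul, hcard,
    Nat.cast_prod]
  refine prod_card_mul_le_sum_prod_card_erase N _ (fun u hu => ?_) D hND hq
  obtain ⟨c, hc, -⟩ := exists_mem_availableColors hf (mem_filter.1 hu).1
  exact ⟨c, hc⟩

/-- The average number of available colors at `v` over all proper colorings of `S` is at least
`q * exp (-2 * D / q)` minus the average number of neighbors of `v` with only one available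
color. -/
theorem card_mul_sub_le_sum_card_availableColors (hG : G.CliqueFree 3) (S : Finset V) (v : V)
    (hq : 0 < q) {D : ℝ} (hD : G.degree v ≤ D) :
    #(partialColorings G q S) * (q * Real.exp (-(2 * D / q))) -
        ∑ u ∈ S with G.Adj v u, (#{f ∈ partialColorings G q S | #(availableColors G f u) ≤ 1} : ℝ)
      ≤ ∑ f ∈ partialColorings G q S, (#(availableColors G f v) : ℝ) := by
  let r : (V → Option (Fin q)) → V → Option (Fin q) := fun f u => if G.Adj v u then none else f u
  have hr : ∀ f g, r g = r f ↔ ∀ u, ¬ G.Adj v u → g u = f u := by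
    intro f g
    simp only [r, funext_iff]
    refine forall_congr' fun u => ?_
    by_cases h : G.Adj v u <;> simp [h]
  have hbad : ∑ u ∈ S with G.Adj v u,
      (#{f ∈ partialColorings G q S | #(availableColors G f u) ≤ 1} : ℝ) =
      ∑ f ∈ partialColorings G q S,
        (#{u ∈ S | G.Adj v u ∧ #(availableColors G f u) ≤ 1} : ℝ) := by
    have := sum_card_bipartiteAbove_eq_sum_card_bipartiteBelow (s := {u ∈ S | G.Adj v u})
      (t := partialColorings G q S) fun u f => #(availableColors G f u) ≤ 1
    simp only [bipartiteAbove, bipartiteBelow, filter_filter] at this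
    exact_mod_cast this
  have hmaps : ∀ f ∈ partialColorings G q S, r f ∈ (partialColorings G q S).image r :=
    fun f hf => mem_image_of_mem r hf
  rw [hbad, ← nsmul_eq_mul, ← sum_const, ← sum_sub_distrib, ← sum_fiberwise_of_maps_to hmaps,
    ← sum_fiberwise_of_maps_to hmaps fun f => (#(availableColors G f v) : ℝ)]
  refine sum_le_sum fun p hp => ?_
  obtain ⟨f, hf, rfl⟩ := mem_image.1 hp
  simp only [hr]
  exact mul_sum_agree_le hG hf v hq hD

theorem mul_card_partialColorings_le (hG : G.CliqueFree 3) (hq : 0 < q) {D l : ℝ} (hl : 0 < l)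
    (hD : ∀ v, G.degree v ≤ D) (hqD : l + D / l ≤ q * Real.exp (-(2 * D / q)))
    (S : Finset V) : ∀ v ∉ S,
      l * #(partialColorings G q S) ≤ #(partialColorings G q (insert v S)) := by
  induction S using Finset.strongInduction with
  | H S ih =>
    intro v hv
    have hbad : ∀ u ∈ ({u ∈ S | G.Adj v u} : Finset V),
        (#{f ∈ partialColorings G q S | #(availableColors G f u) ≤ 1} : ℝ) ≤
          #(partialColorings G q S) / l := by
      intro u hu
      have huS := (mem_filter.1 hu).1
      have h1 := ih _ (erase_ssubset huS) u (notMem_erase u S)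
      rw [insert_erase huS] at h1
      rw [le_div_iff₀ hl, mul_comm]
      refine le_trans (mul_le_mul_of_nonneg_left ?_ hl.le) h1
      exact_mod_cast card_filter_card_availableColors_le_one huS
    have hN : (#{u ∈ S | G.Adj v u} : ℝ) ≤ D := by
      refine le_trans (Nat.cast_le.2 ?_) (hD v)
      rw [← G.card_neighborFinset_eq_degree]
      exact card_le_card fun u hu => (G.mem_neighborFinset v u).2 (mem_filter.1 hu).2
    have h2 := card_mul_sub_le_sum_card_availableColors hG S v hq (hD v)
    have h3 : ∑ f ∈ partialColorings G q S, (#(availableColors G f v) : ℝ) ≤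
        #(partialColorings G q (insert v S)) := by
      exact_mod_cast sum_card_availableColors_le hv
    have h4 := sum_le_sum hbad
    rw [sum_const, nsmul_eq_mul] at h4
    have hP : (0 : ℝ) ≤ #(partialColorings G q S) := Nat.cast_nonneg _
    have h5 : (#{u ∈ S | G.Adj v u} : ℝ) * (#(partialColorings G q S) / l) ≤
        D * (#(partialColorings G q S) / l) := by gcongr
    have h6 := mul_le_mul_of_nonneg_left hqD hP
    have h7 : #(partialColorings G q S) * (l + D / l) =
        l * #(partialColorings G q S) + D * (#(partialColorings G q S) / l) := by ring
    linarith

theorem partialColorings_nonempty (hG : G.CliqueFree 3) (hq : 0 < q) {D l : ℝ} (hl : 0 < l)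
    (hD : ∀ v, G.degree v ≤ D) (hqD : l + D / l ≤ q * Real.exp (-(2 * D / q)))
    (S : Finset V) : (partialColorings G q S).Nonempty := by
  induction S using Finset.induction_on with
  | empty => exact ⟨fun _ => none, by simp [mem_partialColorings]⟩
  | insert v S hv ih =>
    have h := mul_card_partialColorings_le hG hq hl hD hqD S v hv
    have h1 : (0 : ℝ) < #(partialColorings G q S) := by exact_mod_cast ih.card_pos
    have h2 : (0 : ℝ) < #(partialColorings G q (insert v S)) := (mul_pos hl h1).trans_le h
    exact card_pos.1 (by exact_mod_cast h2)

theorem colorable_of_cliqueFree_three (hG : G.CliqueFree 3) (hq : 0 < q) {D l : ℝ} (hl : 0 < l)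
    (hD : ∀ v, G.degree v ≤ D) (hqD : l + D / l ≤ q * Real.exp (-(2 * D / q))) :
    G.Colorable q := by
  obtain ⟨f, hf⟩ := partialColorings_nonempty hG hq hl hD hqD univ
  choose c _ hc using fun v => exists_mem_availableColors hf (mem_univ v)
  exact ⟨SimpleGraph.Coloring.mk c fun {u v} huv h =>
    (mem_partialColorings.1 hf).2 u v huv (c u) (hc u) (h ▸ hc v)⟩

end Counting

theorem two_mul_sqrt_le_mul_exp {D q : ℝ} (hD : 1 < D) (hq : 16 * D / Real.log D ≤ q) :
    2 * √D ≤ q * Real.exp (-(2 * D / q)) := by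
  have hD0 : 0 < D := by linarith
  have hlog : 0 < Real.log D := Real.log_pos hD
  have hq0 : 0 < q := lt_of_lt_of_le (by positivity) hq
  set t := Real.exp (Real.log D / 4) with ht
  have ht0 : 0 < t := Real.exp_pos _
  have ht4 : t ^ 4 = D := by
    rw [ht, ← Real.exp_nat_mul]
    rw [show ((4 : ℕ) : ℝ) * (Real.log D / 4) = Real.log D by push_cast; ring, Real.exp_log hD0]
  have hlogt : Real.log D ≤ 4 * t := by linarith [Real.add_one_le_exp (Real.log D / 4)]
  have hsqrt : √D = t ^ 2 := by
    rw [← ht4, show t ^ 4 = (t ^ 2) ^ 2 by ring, Real.sqrt_sq (by positivity)]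
  have hqt : 4 * t ^ 3 ≤ q := by
    refine le_trans ?_ hq
    rw [le_div_iff₀ hlog]
    calc 4 * t ^ 3 * Real.log D ≤ 4 * t ^ 3 * (4 * t) := by gcongr
      _ = 16 * t ^ 4 := by ring
      _ = 16 * D := by rw [ht4]
  have hexp : t⁻¹ ≤ Real.exp (-(2 * D / q)) := by
    rw [ht, ← Real.exp_neg, Real.exp_le_exp, neg_le_neg_iff, div_le_iff₀ hq0]
    rw [div_le_iff₀ hlog] at hq
    linarith
  rw [hsqrt]
  calc 2 * t ^ 2 ≤ 4 * t ^ 3 * t⁻¹ := by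
        rw [show 4 * t ^ 3 * t⁻¹ = 4 * t ^ 2 by field_simp]
        nlinarith [sq_nonneg t]
    _ ≤ q * Real.exp (-(2 * D / q)) := by gcongr

/-- Johansson's theorem: there exist `C > 0` and `Δ₀` such that
every triangle-free simple graph `G` with maximum degree at most `Δ ≥ Δ₀` satisfies
`χ(G) ≤ C Δ / log Δ`. -/
theorem statement_14 :
    ∃ C : ℝ, 0 < C ∧ ∃ Δ₀ : ℕ, ∀ (V : Type) [Fintype V] [DecidableEq V]
      (G : SimpleGraph V) [DecidableRel G.Adj] (Δ : ℕ), Δ₀ ≤ Δ →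
      G.CliqueFree 3 →
      (∀ v : V, G.degree v ≤ Δ) →
      ∃ n : ℕ, G.Colorable n ∧ (n : ℝ) ≤ C * (Δ : ℝ) / Real.log Δ := by
  refine ⟨17, by norm_num, 2, fun V _ _ G _ Δ hΔ hG hdeg => ?_⟩
  have hD : (1 : ℝ) < Δ := by exact_mod_cast hΔ
  have hD0 : (0 : ℝ) < Δ := by linarith
  have hlog : 0 < Real.log Δ := Real.log_pos hD
  have hpos : 0 < 16 * (Δ : ℝ) / Real.log Δ := by positivity
  refine ⟨⌈16 * (Δ : ℝ) / Real.log Δ⌉₊, ?_, ?_⟩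
  · refine colorable_of_cliqueFree_three hG (Nat.ceil_pos.2 hpos) (Real.sqrt_pos.2 hD0)
      (fun v => Nat.cast_le.2 (hdeg v)) ?_
    rw [Real.div_sqrt, ← two_mul]
    exact two_mul_sqrt_le_mul_exp hD (Nat.le_ceil _)
  · have h1 : 1 ≤ (Δ : ℝ) / Real.log Δ := by
      rw [le_div_iff₀ hlog]
      linarith [Real.log_le_sub_one_of_pos hD0]
    calc (⌈16 * (Δ : ℝ) / Real.log Δ⌉₊ : ℝ) ≤ 16 * (Δ : ℝ) / Real.log Δ + 1 :=
          (Nat.ceil_lt_add_one hpos.le).le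
      _ ≤ 16 * (Δ : ℝ) / Real.log Δ + Δ / Real.log Δ := by gcongr
      _ = 17 * (Δ : ℝ) / Real.log Δ := by ring
end

section
/- There exist constants C > 0 and Δ₀ such that the following holds for every Δ ≥ Δ₀ and every real f with 2 ≤ f ≤ Δ²: if G is a finite simple graph with maximum degree at most Δ in which every vertex lies in at most Δ²/f triangles, then χ(G) ≤ C·Δ/log f. -/
namespace LocallySparse

open Finset Function

section

set_option linter.unusedSectionVars false

/-- The colors that `σ` does not use on `Y`. -/
def freeColors {V κ : Type*} [Fintype κ] [DecidableEq κ] (σ : V → κ) (Y : Finset V) : Finset κ :=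
  {c | ∀ b ∈ Y, σ b ≠ c}

variable {V κ : Type*} [Fintype V] [DecidableEq V] [Fintype κ] [DecidableEq κ]
  (G : SimpleGraph V) [DecidableRel G.Adj]

variable (κ) in
/-- All maps `V → κ` that are proper colorings of the subgraph induced on `X`. -/
def properOn (X : Finset V) : Finset (V → κ) :=
  {σ | ∀ a ∈ X, ∀ b ∈ X, G.Adj a b → σ a ≠ σ b}

/-- The neighbors of `v` inside `X`. -/
def nbrsIn (X : Finset V) (v : V) : Finset V := {u ∈ X | G.Adj v u}

variable {G}

lemma mem_properOn {X : Finset V} {σ : V → κ} :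
    σ ∈ properOn κ G X ↔ ∀ a ∈ X, ∀ b ∈ X, G.Adj a b → σ a ≠ σ b := by
  simp [properOn]

lemma mem_nbrsIn {X : Finset V} {v u : V} : u ∈ nbrsIn G X v ↔ u ∈ X ∧ G.Adj v u := by
  simp [nbrsIn]

lemma mem_freeColors {σ : V → κ} {Y : Finset V} {c : κ} :
    c ∈ freeColors σ Y ↔ ∀ b ∈ Y, σ b ≠ c := by
  simp [freeColors]

lemma freeColors_update {σ : V → κ} {Y : Finset V} {v : V} (hv : v ∉ Y) (c : κ) :
    freeColors (update σ v c) Y = freeColors σ Y := by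
  ext d
  simp only [mem_freeColors]
  refine forall₂_congr fun b hb => ?_
  rw [update_of_ne (by rintro rfl; exact hv hb)]

lemma update_mem_properOn {X : Finset V} {σ : V → κ} {v : V} (hv : v ∉ X) (c : κ) :
    update σ v c ∈ properOn κ G X ↔ σ ∈ properOn κ G X := by
  simp only [mem_properOn]
  refine forall₂_congr fun a ha => forall₂_congr fun b hb => ?_
  rw [update_of_ne (by rintro rfl; exact hv ha), update_of_ne (by rintro rfl; exact hv hb)]

lemma mem_properOn_insert {X : Finset V} {σ : V → κ} {v : V} :
    σ ∈ properOn κ G (insert v X) ↔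
      σ ∈ properOn κ G X ∧ σ v ∈ freeColors σ (nbrsIn G X v) := by
  simp only [mem_properOn, mem_freeColors, mem_nbrsIn, mem_insert]
  constructor
  · intro h
    exact ⟨fun a ha b hb => h a (.inr ha) b (.inr hb),
      fun b hb => (h v (.inl rfl) b (.inr hb.1) hb.2).symm⟩
  · rintro ⟨h1, h2⟩ a (rfl | ha) b (rfl | hb) hab
    · exact (G.irrefl hab).elim
    · exact (h2 b ⟨hb, hab⟩).symm
    · exact h2 a ⟨ha, hab.symm⟩
    · exact h1 a ha b hb hab

/-- Double counting of the extensions of colorings of `X` to a new vertex `v`. -/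
lemma card_mul_card_properOn_insert {X : Finset V} {v : V} (hv : v ∉ X)
    (P : (V → κ) → Prop) [DecidablePred P] (hP : ∀ σ c, P (update σ v c) ↔ P σ) :
    #{σ ∈ properOn κ G (insert v X) | P σ} * Fintype.card κ =
      ∑ σ ∈ properOn κ G X with P σ, #(freeColors σ (nbrsIn G X v)) := by
  have hN : v ∉ nbrsIn G X v := fun h => hv (mem_nbrsIn.1 h).1
  rw [← card_sigma, ← card_univ, ← card_product]
  refine card_nbij' (fun p => ⟨update p.1 v p.2, p.1 v⟩) (fun p => (update p.1 v p.2, p.1 v))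
    ?_ ?_ ?_ ?_
  · rintro ⟨σ, c⟩ h
    simp only [coe_product, Set.mem_prod, mem_coe, mem_filter, mem_properOn_insert] at h
    simp only [coe_sigma, Set.mem_sigma_iff, mem_coe, mem_filter, update_mem_properOn hv, hP,
      freeColors_update hN]
    exact ⟨⟨h.1.1.1, h.1.2⟩, h.1.1.2⟩
  · rintro ⟨σ, c⟩ h
    simp only [coe_sigma, Set.mem_sigma_iff, mem_coe, mem_filter] at h
    simp only [coe_product, Set.mem_prod, mem_coe, mem_filter, mem_properOn_insert,
      update_mem_properOn hv, hP, freeColors_update hN, update_self, mem_univ, and_true]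
    exact ⟨⟨h.1.1, h.2⟩, h.1.2⟩
  · rintro ⟨σ, c⟩ _
    simp
  · rintro ⟨σ, c⟩ _
    simp

/-- Few colorings of `X` leave at most `t` choices for the color of a given `u ∈ X`. -/
lemma card_few_choices_le {X : Finset V} {u : V} (hu : u ∈ X) {t : ℝ} (ht : 0 ≤ t) :
    (#{σ ∈ properOn κ G X | (#(freeColors σ (nbrsIn G X u)) : ℝ) ≤ t} : ℝ) * Fintype.card κ ≤
      t * #(properOn κ G (X.erase u)) := by
  have hN : u ∉ nbrsIn G X u := fun h => G.irrefl (mem_nbrsIn.1 h).2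
  have hE : nbrsIn G (X.erase u) u = nbrsIn G X u := by
    ext b
    simp only [mem_nbrsIn, mem_erase]
    exact ⟨fun h => ⟨h.1.2, h.2⟩, fun h => ⟨⟨h.2.ne', h.1⟩, h.2⟩⟩
  have key := card_mul_card_properOn_insert (G := G) (notMem_erase u X)
    (fun σ : V → κ => (#(freeColors σ (nbrsIn G X u)) : ℝ) ≤ t)
    (fun σ c => by rw [freeColors_update hN])
  rw [insert_erase hu, hE] at key
  have key' := congrArg (Nat.cast : ℕ → ℝ) key
  push_cast at key'
  rw [key']
  calc _ ≤ ∑ σ ∈ properOn κ G (X.erase u) with (#(freeColors σ (nbrsIn G X u)) : ℝ) ≤ t, t :=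
        sum_le_sum fun σ hσ => (mem_filter.1 hσ).2
    _ ≤ _ := by
        rw [sum_const, nsmul_eq_mul, mul_comm]
        gcongr
        exact filter_subset _ _

/-- If every vertex of `S` can be recolored within the family `F` in at least `q u` ways, then
the proportion of `σ ∈ F` avoiding `c` on `S` is at least a product of local factors. -/
lemma mul_prod_le_card_avoiding (F : Finset (V → κ)) (S : Finset V) (A : V → Finset κ)
    (q : V → ℝ) (hq : ∀ u ∈ S, 1 ≤ q u) (hA : ∀ σ ∈ F, ∀ u ∈ S, σ u ∈ A u)
    (hF : ∀ σ ∈ F, ∀ u ∈ S, q u ≤ #{c | update σ u c ∈ F}) (c : κ) :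
    (#F : ℝ) * ∏ u ∈ S, (1 - if c ∈ A u then 1 / q u else 0) ≤
      #{σ ∈ F | c ∈ freeColors σ S} := by
  induction S using Finset.induction_on with
  | empty => simp [mem_freeColors]
  | insert u S hu ih =>
    have ih' := ih (fun w hw => hq w (mem_insert_of_mem hw))
      (fun σ hσ w hw => hA σ hσ w (mem_insert_of_mem hw))
      (fun σ hσ w hw => hF σ hσ w (mem_insert_of_mem hw))
    have hqu := hq u (mem_insert_self u S)
    have hq0 : 0 < q u := by linarith
    set M : Finset (V → κ) := {σ ∈ F | c ∈ freeColors σ S} with hM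
    have hsplit : #{σ ∈ M | σ u = c} + #{σ ∈ F | c ∈ freeColors σ (insert u S)} = #M := by
      rw [← card_filter_add_card_filter_not (s := M) (fun σ => σ u = c)]
      congr 2
      ext σ
      simp only [hM, mem_filter, mem_freeColors, forall_mem_insert]
      tauto
    have hbad : (#{σ ∈ M | σ u = c} : ℝ) ≤ (if c ∈ A u then 1 / q u else 0) * #M := by
      split_ifs with hc
      · rw [one_div, inv_mul_eq_div, le_div_iff₀ hq0]
        have h1 : (#{σ ∈ M | σ u = c} : ℝ) * q u ≤
            #(({σ ∈ M | σ u = c}).sigma fun σ => ({d | update σ u d ∈ F} : Finset κ)) := by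
          rw [card_sigma, Nat.cast_sum, ← nsmul_eq_mul, ← sum_const]
          refine sum_le_sum fun σ hσ => ?_
          exact hF σ (by simp [hM] at hσ; exact hσ.1.1) u (mem_insert_self u S)
        refine h1.trans ?_
        norm_cast
        refine card_le_card_of_injOn (fun p => update p.1 u p.2) ?_ ?_
        · rintro ⟨σ, d⟩ h
          simp only [coe_sigma, Set.mem_sigma_iff, mem_coe, mem_filter, hM, mem_univ,
            true_and] at h ⊢
          exact ⟨h.2, by rw [freeColors_update hu]; exact h.1.1.2⟩
        · rintro ⟨σ, d⟩ h ⟨τ, e⟩ h' heq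
          simp only [coe_sigma, Set.mem_sigma_iff, mem_coe, mem_filter] at h h'
          have hde : d = e := by simpa using congrFun heq u
          have hst : σ = τ := by
            have := congrArg (fun ρ => update ρ u c) heq
            simp only [update_idem] at this
            rw [← h.1.2] at this
            rw [update_eq_self, h.1.2, ← h'.1.2, update_eq_self] at this
            exact this
          subst hde hst
          rfl
      · rw [zero_mul, filter_false_of_mem]
        · simp
        · rintro σ hσ rfl
          exact hc (hA σ (mem_filter.1 hσ).1 u (mem_insert_self u S))
    have hfac : (0 : ℝ) ≤ 1 - if c ∈ A u then 1 / q u else 0 := by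
      split_ifs
      · rw [sub_nonneg, div_le_one hq0]; exact hqu
      · simp
    rw [prod_insert hu]
    calc _ = (1 - if c ∈ A u then 1 / q u else 0) *
          ((#F : ℝ) * ∏ u ∈ S, (1 - if c ∈ A u then 1 / q u else 0)) := by ring
      _ ≤ (1 - if c ∈ A u then 1 / q u else 0) * #M := by gcongr
      _ ≤ _ := by
        have := congrArg (Nat.cast : ℕ → ℝ) hsplit
        push_cast at this
        linarith

lemma exp_neg_two_mul_le {p : ℝ} (h0 : 0 ≤ p) (h1 : p ≤ 1 / 2) :
    Real.exp (-(2 * p)) ≤ 1 - p := by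
  rw [Real.exp_neg, inv_le_comm₀ (Real.exp_pos _) (by linarith)]
  refine le_trans ?_ (Real.add_one_le_exp (2 * p))
  rw [inv_le_iff_one_le_mul₀ (by linarith)]
  nlinarith

/-- Jensen's inequality for the exponential, unnormalized. -/
lemma card_mul_exp_le_sum_exp [Nonempty κ] (x : κ → ℝ) {B : ℝ} (hB : ∑ c, x c ≤ B) :
    (Fintype.card κ : ℝ) * Real.exp (-(B / Fintype.card κ)) ≤ ∑ c, Real.exp (-x c) := by
  have hk : (0 : ℝ) < Fintype.card κ := by exact_mod_cast Fintype.card_pos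
  have h := convexOn_exp.map_sum_le (t := (univ : Finset κ))
    (w := fun _ => (Fintype.card κ : ℝ)⁻¹) (p := fun c => -x c)
    (fun _ _ => by positivity) (by simp [hk.ne']) (fun _ _ => Set.mem_univ _)
  simp only [smul_eq_mul, ← mul_sum, sum_neg_distrib] at h
  rw [← le_inv_mul_iff₀ hk]
  refine le_trans (Real.exp_le_exp.2 ?_) h
  rw [div_eq_inv_mul, mul_neg]
  gcongr

lemma card_mul_exp_le_sum_card_freeColors [Nonempty κ] (F : Finset (V → κ)) (S : Finset V)
    (A : V → Finset κ) (q : V → ℝ) (hq : ∀ u ∈ S, 2 ≤ q u) (hAq : ∀ u ∈ S, (#(A u) : ℝ) ≤ 2 * q u)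
    (hA : ∀ σ ∈ F, ∀ u ∈ S, σ u ∈ A u)
    (hF : ∀ σ ∈ F, ∀ u ∈ S, q u ≤ #{c | update σ u c ∈ F}) {d : ℝ} (hd : (#S : ℝ) ≤ d) :
    (#F : ℝ) * (Fintype.card κ * Real.exp (-(4 * d / Fintype.card κ))) ≤
      ∑ σ ∈ F, (#(freeColors σ S) : ℝ) := by
  have hswap : ∑ σ ∈ F, (#(freeColors σ S) : ℝ) = ∑ c, (#{σ ∈ F | c ∈ freeColors σ S} : ℝ) := by
    norm_cast
    simp only [card_filter]
    rw [sum_comm]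
    exact sum_congr rfl fun σ _ => by simp [freeColors]
  set x : κ → ℝ := fun c => ∑ u ∈ S, 2 * if c ∈ A u then 1 / q u else 0 with hx
  have hxd : ∑ c, x c ≤ 4 * d := by
    rw [hx, sum_comm]
    calc _ ≤ ∑ u ∈ S, (4 : ℝ) := by
          refine sum_le_sum fun u hu => ?_
          have h2 := hq u hu
          have h3 := hAq u hu
          rw [← mul_sum, sum_ite_mem, univ_inter, sum_const, nsmul_eq_mul, mul_one_div,
            ← mul_div_assoc, div_le_iff₀ (by linarith)]
          linarith
      _ ≤ 4 * d := by rw [sum_const, nsmul_eq_mul]; linarith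
  rw [hswap]
  calc _ ≤ (#F : ℝ) * ∑ c, Real.exp (-x c) := by
        gcongr
        exact card_mul_exp_le_sum_exp x hxd
    _ = ∑ c, (#F : ℝ) * Real.exp (-x c) := mul_sum _ _ _
    _ ≤ _ := by
        refine sum_le_sum fun c _ => ?_
        refine le_trans ?_ (mul_prod_le_card_avoiding F S A q
          (fun u hu => by linarith [hq u hu]) hA hF c)
        gcongr
        rw [hx, ← sum_neg_distrib, Real.exp_sum]
        refine prod_le_prod (fun _ _ => (Real.exp_pos _).le) fun u hu => ?_
        have h2 := hq u hu
        apply exp_neg_two_mul_le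
        · split_ifs <;> positivity
        · split_ifs
          · gcongr
          · norm_num

/-- Rerandomizing the colors on `W` shows that the colors of the vertices of `W` which keep many
choices miss, on average, many colors. -/
lemma card_mul_le_sum_card_freeColors_of_sparse [Nonempty κ] {X W : Finset V} (hW : W ⊆ X)
    {D t d : ℝ} (hD : ∀ u ∈ W, (#(nbrsIn G W u) : ℝ) ≤ D) (h2D : 2 * D ≤ t) (hD2 : D + 2 ≤ t)
    (hd : (#W : ℝ) ≤ d) :
    (#(properOn κ G X) : ℝ) * (Fintype.card κ * Real.exp (-(4 * d / Fintype.card κ))) ≤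
      ∑ σ ∈ properOn κ G X,
        (#(freeColors σ {u ∈ W | t < #(freeColors σ (nbrsIn G X u \ W))}) : ℝ) := by
  let r : (V → κ) → ({x // x ∉ W} → κ) := fun σ x => σ x
  have hcard : (#(properOn κ G X) : ℝ) = ∑ j, (#{σ ∈ properOn κ G X | r σ = j} : ℝ) := by
    exact_mod_cast card_eq_sum_card_fiberwise (f := r) (t := univ) fun _ _ => by simp
  rw [hcard, sum_mul, ← sum_fiberwise (properOn κ G X) r]
  refine sum_le_sum fun j _ => ?_
  set F : Finset (V → κ) := {σ ∈ properOn κ G X | r σ = j} with hF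
  rcases F.eq_empty_or_nonempty with h0 | ⟨σ₀, hσ₀⟩
  · simp [h0]
  have hagree : ∀ σ ∈ F, ∀ x ∉ W, σ x = σ₀ x := by
    intro σ hσ x hx
    have h1 := (mem_filter.1 hσ).2
    have h2 := (mem_filter.1 hσ₀).2
    exact congrFun (h1.trans h2.symm) ⟨x, hx⟩
  have hfree : ∀ σ ∈ F, ∀ u, freeColors σ (nbrsIn G X u \ W) =
      freeColors σ₀ (nbrsIn G X u \ W) := by
    intro σ hσ u
    ext c
    simp only [mem_freeColors]
    refine forall₂_congr fun b hb => ?_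
    rw [hagree σ hσ b (mem_sdiff.1 hb).2]
  set A : V → Finset κ := fun u => freeColors σ₀ (nbrsIn G X u \ W) with hA
  set S : Finset V := {u ∈ W | t < #(A u)} with hS
  have hSW : S ⊆ W := filter_subset _ _
  have hSt : ∀ u ∈ S, t < #(A u) := fun u hu => (mem_filter.1 hu).2
  have key := card_mul_exp_le_sum_card_freeColors F S A (fun u => #(A u) - D)
    (fun u hu => by linarith [hSt u hu]) (fun u hu => by linarith [hSt u hu]) ?_ ?_
    (d := d) (le_trans (by exact_mod_cast card_le_card hSW) hd)
  · refine key.trans (le_of_eq (sum_congr rfl fun σ hσ => ?_))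
    simp only [hfree σ hσ, hS, hA]
  · intro σ hσ u hu
    change σ u ∈ freeColors σ₀ _
    rw [← hfree σ hσ u, mem_freeColors]
    intro b hb
    have hb' := mem_nbrsIn.1 (mem_sdiff.1 hb).1
    exact (mem_properOn.1 (mem_filter.1 hσ).1 u (hW (hSW hu)) b hb'.1 hb'.2).symm
  · intro σ hσ u hu
    have huW := hSW hu
    have hsub : A u \ (nbrsIn G W u).image σ ⊆ ({c | update σ u c ∈ F} : Finset κ) := by
      intro c hc
      change c ∈ freeColors σ₀ _ \ _ at hc
      rw [← hfree σ hσ u, mem_sdiff, mem_freeColors, mem_image] at hc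
      have hne : ∀ b ∈ X, G.Adj u b → c ≠ σ b := by
        rintro b hb hub rfl
        by_cases hbW : b ∈ W
        · exact hc.2 ⟨b, mem_nbrsIn.2 ⟨hbW, hub⟩, rfl⟩
        · exact hc.1 b (mem_sdiff.2 ⟨mem_nbrsIn.2 ⟨hb, hub⟩, hbW⟩) rfl
      have hσX := mem_properOn.1 (mem_filter.1 hσ).1
      simp only [mem_filter, mem_univ, true_and, hF, mem_properOn]
      refine ⟨fun a ha b hb hab => ?_, ?_⟩
      · rcases eq_or_ne a u with rfl | hau
        · rw [update_self, update_of_ne hab.ne']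
          exact hne b hb hab
        · rw [update_of_ne hau]
          rcases eq_or_ne b u with rfl | hbu
          · rw [update_self]
            exact (hne a ha hab.symm).symm
          · rw [update_of_ne hbu]
            exact hσX a ha b hb hab
      · rw [← (mem_filter.1 hσ).2]
        funext x
        exact update_of_ne (by rintro rfl; exact x.2 huW) _ _
    have h1 : #(A u) ≤ #({c | update σ u c ∈ F} : Finset κ) + #(nbrsIn G W u) := by
      refine (card_le_card_sdiff_add_card (t := (nbrsIn G W u).image σ)).trans ?_
      exact add_le_add (card_le_card hsub) card_image_le
    have h2 : (#(A u) : ℝ) ≤ #({c | update σ u c ∈ F} : Finset κ) + #(nbrsIn G W u) := by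
      exact_mod_cast h1
    linarith [hD u huW]

lemma card_freeColors_le_add (σ : V → κ) (S N : Finset V) :
    #(freeColors σ S) ≤ #(freeColors σ N) + #(N \ S) := by
  have hsub : freeColors σ S ⊆ freeColors σ N ∪ (N \ S).image σ := by
    intro c hc
    simp only [mem_union, mem_freeColors, mem_image, mem_sdiff] at hc ⊢
    by_contra! h
    obtain ⟨⟨b, hb, hbc⟩, h⟩ := h
    exact h b ⟨hb, fun hbS => hc b hbS hbc⟩ hbc
  exact (card_le_card hsub).trans ((card_union_le _ _).trans (by gcongr; exact card_image_le))

/-- One step of the counting argument: adding a vertex `v` with sparse neighborhood multiplies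
the number of proper colorings by at least `l`. -/
lemma mul_card_properOn_le [Nonempty κ] {X : Finset V} {v : V} (hv : v ∉ X) {l : ℝ} (hl : 0 < l)
    (hprev : ∀ u ∈ X, l * #(properOn κ G (X.erase u)) ≤ #(properOn κ G X) * Fintype.card κ)
    {W : Finset V} (hW : W ⊆ nbrsIn G X v) {D t d e : ℝ} (ht : 0 ≤ t)
    (hD : ∀ u ∈ W, (#(nbrsIn G W u) : ℝ) ≤ D) (h2D : 2 * D ≤ t) (hD2 : D + 2 ≤ t)
    (hd : (#W : ℝ) ≤ d) (he : (#(nbrsIn G X v \ W) : ℝ) ≤ e)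
    (hk : l + e + d * (t / l) ≤ Fintype.card κ * Real.exp (-(4 * d / Fintype.card κ))) :
    l * #(properOn κ G X) ≤ #(properOn κ G (insert v X)) * Fintype.card κ := by
  have hκ : (0 : ℝ) < Fintype.card κ := by exact_mod_cast Fintype.card_pos
  have hWX : W ⊆ X := fun u hu => (mem_nbrsIn.1 (hW hu)).1
  have hext := card_mul_card_properOn_insert (κ := κ) (G := G) hv (fun _ => True) (by simp)
  simp only [filter_true] at hext
  have hext' := congrArg (Nat.cast : ℕ → ℝ) hext
  push_cast at hext'
  rw [hext']
  have hrand := card_mul_le_sum_card_freeColors_of_sparse (κ := κ) hWX hD h2D hD2 hd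
  have hbad : ∑ σ ∈ properOn κ G X,
      (#{u ∈ W | ¬ t < #(freeColors σ (nbrsIn G X u \ W))} : ℝ) ≤
      d * (t / l) * #(properOn κ G X) := by
    have hswap : ∑ σ ∈ properOn κ G X,
        (#{u ∈ W | ¬ t < #(freeColors σ (nbrsIn G X u \ W))} : ℝ) =
        ∑ u ∈ W, (#{σ ∈ properOn κ G X | ¬ t < #(freeColors σ (nbrsIn G X u \ W))} : ℝ) := by
      norm_cast
      simp only [card_filter]
      exact sum_comm
    rw [hswap]
    calc _ ≤ ∑ u ∈ W, t / l * #(properOn κ G X) := by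
          refine sum_le_sum fun u hu => ?_
          have h1 := card_few_choices_le (κ := κ) (G := G) (hWX hu) ht
          have h2 := hprev u (hWX hu)
          have h3 : (#{σ ∈ properOn κ G X | ¬ t < #(freeColors σ (nbrsIn G X u \ W))} : ℝ) ≤
              #{σ ∈ properOn κ G X | (#(freeColors σ (nbrsIn G X u)) : ℝ) ≤ t} := by
            norm_cast
            refine card_le_card fun σ hσ => ?_
            simp only [mem_filter, not_lt] at hσ ⊢
            refine ⟨hσ.1, le_trans ?_ hσ.2⟩
            norm_cast
            refine card_le_card fun c hc => ?_
            rw [mem_freeColors] at hc ⊢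
            exact fun b hb => hc b (mem_sdiff.1 hb).1
          refine h3.trans (le_of_mul_le_mul_right ?_ hκ)
          refine h1.trans ?_
          calc t * (#(properOn κ G (X.erase u)) : ℝ) =
                t / l * (l * #(properOn κ G (X.erase u))) := by field_simp
            _ ≤ t / l * (#(properOn κ G X) * Fintype.card κ) := by gcongr
            _ = _ := by ring
      _ = #W * (t / l * #(properOn κ G X)) := by rw [sum_const, nsmul_eq_mul]
      _ ≤ d * (t / l * #(properOn κ G X)) := by gcongr
      _ = _ := by ring
  have hpt : ∀ σ ∈ properOn κ G X,
      (#(freeColors σ {u ∈ W | t < #(freeColors σ (nbrsIn G X u \ W))}) : ℝ) ≤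
        #(freeColors σ (nbrsIn G X v)) +
          (e + #{u ∈ W | ¬ t < #(freeColors σ (nbrsIn G X u \ W))}) := by
    intro σ _
    have h1 := card_freeColors_le_add σ {u ∈ W | t < #(freeColors σ (nbrsIn G X u \ W))}
      (nbrsIn G X v)
    have h2 : nbrsIn G X v \ {u ∈ W | t < #(freeColors σ (nbrsIn G X u \ W))} ⊆
        (nbrsIn G X v \ W) ∪ {u ∈ W | ¬ t < #(freeColors σ (nbrsIn G X u \ W))} := by
      intro u hu
      simp only [mem_union, mem_sdiff, mem_filter] at hu ⊢
      tauto
    have h3 := (card_le_card h2).trans (card_union_le _ _)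
    have h4 := h1.trans (Nat.add_le_add_left h3 _)
    have h5 : (#(freeColors σ {u ∈ W | t < #(freeColors σ (nbrsIn G X u \ W))}) : ℝ) ≤
        #(freeColors σ (nbrsIn G X v)) + (#(nbrsIn G X v \ W) +
          #{u ∈ W | ¬ t < #(freeColors σ (nbrsIn G X u \ W))}) := by exact_mod_cast h4
    linarith
  have hsum := sum_le_sum hpt
  simp only [sum_add_distrib, sum_const, nsmul_eq_mul] at hsum
  have hmul := mul_le_mul_of_nonneg_left hk (Nat.cast_nonneg (α := ℝ) #(properOn κ G X))
  linarith

lemma colorable_of_properOn_univ_nonempty (h : (properOn κ G univ).Nonempty) :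
    G.Colorable (Fintype.card κ) := by
  obtain ⟨σ, hσ⟩ := h
  exact (SimpleGraph.Coloring.mk σ fun {a b} hab =>
    mem_properOn.1 hσ a (mem_univ a) b (mem_univ b) hab).colorable

lemma card_nbrsIn_le_degree (X : Finset V) (v : V) : #(nbrsIn G X v) ≤ G.degree v := by
  rw [← G.card_neighborFinset_eq_degree]
  exact card_le_card fun u hu => (G.mem_neighborFinset v u).2 (mem_nbrsIn.1 hu).2

/-- The greedy bound. -/
lemma colorable_of_degree_lt {n : ℕ} (h : ∀ v, G.degree v < n) : G.Colorable n := by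
  rcases isEmpty_or_nonempty V with hV | ⟨⟨v₀⟩⟩
  · exact .of_isEmpty n
  have hn : 0 < n := (Nat.zero_le _).trans_lt (h v₀)
  have : NeZero n := ⟨hn.ne'⟩
  rw [← Fintype.card_fin n]
  refine colorable_of_properOn_univ_nonempty ?_
  induction (univ : Finset V) using Finset.induction_on with
  | empty => exact ⟨fun _ => 0, by simp [mem_properOn]⟩
  | insert v X hv ih =>
    obtain ⟨σ, hσ⟩ := ih
    have hlt : #((nbrsIn G X v).image σ) < #(univ : Finset (Fin n)) := by
      rw [card_univ, Fintype.card_fin]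
      exact card_image_le.trans_lt ((card_nbrsIn_le_degree X v).trans_lt (h v))
    obtain ⟨c, -, hc⟩ := exists_mem_notMem_of_card_lt_card hlt
    refine ⟨update σ v c, mem_properOn_insert.2 ⟨(update_mem_properOn hv c).2 hσ, ?_⟩⟩
    rw [freeColors_update (fun h => hv (mem_nbrsIn.1 h).1), update_self, mem_freeColors]
    exact fun b hb hbc => hc (mem_image.2 ⟨b, hb, hbc⟩)

/-- The degree sum of a neighborhood is at most twice the number of triangles. -/
lemma sum_card_nbrsIn_le (X : Finset V) (v : V) :
    ∑ u ∈ nbrsIn G X v, #(nbrsIn G (nbrsIn G X v) u) ≤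
      2 * {t : Finset V | v ∈ t ∧ G.IsNClique 3 t}.ncard := by
  rw [← card_sigma]
  set P := (nbrsIn G X v).sigma fun u => nbrsIn G (nbrsIn G X v) u with hP
  let g : (Σ _ : V, V) → Finset V := fun p => {v, p.1, p.2}
  have hmem : ∀ p ∈ P, G.Adj v p.1 ∧ G.Adj v p.2 ∧ G.Adj p.1 p.2 := by
    rintro ⟨u, w⟩ h
    simp only [hP, mem_sigma, mem_nbrsIn] at h
    exact ⟨h.1.2, h.2.1.2, h.2.2⟩
  have himage : #(P.image g) ≤ {t : Finset V | v ∈ t ∧ G.IsNClique 3 t}.ncard := by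
    rw [← Set.ncard_coe_finset]
    refine Set.ncard_le_ncard ?_ (Set.toFinite _)
    intro t ht
    obtain ⟨p, hp, rfl⟩ := mem_image.1 (mem_coe.1 ht)
    obtain ⟨h1, h2, h3⟩ := hmem p hp
    exact ⟨by simp [g], SimpleGraph.is3Clique_iff.2 ⟨v, p.1, p.2, h1, h2, h3, rfl⟩⟩
  refine (card_le_mul_card_image P 2 fun t ht => ?_).trans (Nat.mul_le_mul_left 2 himage)
  obtain ⟨p, hp, rfl⟩ := mem_image.1 ht
  have hcard : #((g p).erase v) ≤ 2 := by
    rw [card_erase_of_mem (by simp [g])]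
    have := card_le_three (a := v) (b := p.1) (c := p.2)
    simp only [g]
    omega
  have hoff : #((g p).erase v).offDiag ≤ 2 := by
    rw [offDiag_card]
    interval_cases #((g p).erase v) <;> simp
  refine le_trans (card_le_card_of_injOn (fun q => (q.1, q.2)) ?_ ?_) hoff
  · intro q hq
    simp only [mem_coe, mem_filter] at hq
    obtain ⟨h1, h2, h3⟩ := hmem q hq.1
    rw [← hq.2]
    simp [g, h1.ne', h2.ne', h3.ne]
  · rintro ⟨a, b⟩ _ ⟨a', b'⟩ _ h
    simp only [Prod.mk.injEq] at h
    obtain ⟨rfl, rfl⟩ := h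
    rfl

/-- The coloring bound in terms of `s`, where `f = s ^ 16`. -/
lemma colorable_of_locally_sparse {d s : ℝ} {k : ℕ} (hs : 2 ≤ s) (hsd : s ^ 8 ≤ d)
    (hdeg : ∀ v, (G.degree v : ℝ) ≤ d)
    (htri : ∀ v, ({t : Finset V | v ∈ t ∧ G.IsNClique 3 t}.ncard : ℝ) ≤ d ^ 2 / s ^ 16)
    (hk : 4 * d / Real.log s ≤ k) : G.Colorable k := by
  have hs0 : 0 < s := by linarith
  have hlog : 0 < Real.log s := Real.log_pos (by linarith)
  have hd : 0 < d := lt_of_lt_of_le (by positivity) hsd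
  have hk0 : (0 : ℝ) < k := lt_of_lt_of_le (by positivity) hk
  have hkpos : 0 < k := by exact_mod_cast hk0
  have : NeZero k := ⟨hkpos.ne'⟩
  have hl : 0 < d / s ^ 2 := by positivity
  have hexp : 4 * d / s ^ 2 ≤ k * Real.exp (-(4 * d / k)) := by
    have h1 : 4 * d / k ≤ Real.log s := by
      rw [div_le_iff₀ hk0]
      rw [div_le_iff₀ hlog] at hk
      linarith
    have h2 : s⁻¹ ≤ Real.exp (-(4 * d / k)) := by
      calc s⁻¹ = Real.exp (-Real.log s) := by rw [Real.exp_neg, Real.exp_log hs0]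
        _ ≤ _ := Real.exp_le_exp.2 (neg_le_neg h1)
    have h3 : 4 * d / s ≤ k := by
      refine le_trans ?_ hk
      gcongr
      exact (Real.log_le_sub_one_of_pos hs0).trans (by linarith)
    calc 4 * d / s ^ 2 = 4 * d / s * s⁻¹ := by field_simp
      _ ≤ _ := by gcongr
  have hgrow : ∀ X : Finset V, ∀ v ∉ X, d / s ^ 2 * #(properOn (Fin k) G X) ≤
      #(properOn (Fin k) G (insert v X)) * Fintype.card (Fin k) := by
    intro X
    induction X using Finset.strongInduction with
    | H X ih =>
      intro v hv
      set N := nbrsIn G X v with hN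
      have hWN : {u ∈ N | (#(nbrsIn G N u) : ℝ) ≤ d / s ^ 8} ⊆ N := filter_subset _ _
      have hNd : (#N : ℝ) ≤ d :=
        le_trans (by exact_mod_cast card_nbrsIn_le_degree X v) (hdeg v)
      refine mul_card_properOn_le hv hl (fun u hu => ?_) hWN (D := d / s ^ 8) (t := d / s ^ 6)
        (d := d) (e := 2 * d / s ^ 8) (by positivity) (fun u hu => ?_) ?_ ?_ ?_ ?_ ?_
      · have := ih (X.erase u) (erase_ssubset hu) u (notMem_erase u X)
        rwa [insert_erase hu] at this
      · refine le_trans ?_ (mem_filter.1 hu).2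
        norm_cast
        refine card_le_card fun w hw => ?_
        rw [mem_nbrsIn] at hw ⊢
        exact ⟨hWN hw.1, hw.2⟩
      · rw [← mul_div_assoc, div_le_div_iff₀ (by positivity) (by positivity)]
        have : 2 * s ^ 6 ≤ s ^ 8 := by
          rw [pow_add s 2 6]
          gcongr
          nlinarith
        nlinarith
      · have h1 : 1 ≤ d / s ^ 8 := by rwa [one_le_div (by positivity)]
        have h2 : d / s ^ 6 = d / s ^ 8 * s ^ 2 := by field_simp
        have h3 : 4 ≤ s ^ 2 := by nlinarith
        rw [h2]
        nlinarith
      · exact le_trans (by exact_mod_cast card_le_card hWN) hNd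
      · rw [le_div_iff₀ (by positivity)]
        have h1 : (#(N \ {u ∈ N | (#(nbrsIn G N u) : ℝ) ≤ d / s ^ 8}) : ℝ) * (d / s ^ 8) ≤
            2 * (d ^ 2 / s ^ 16) := by
          calc _ = ∑ u ∈ N \ {u ∈ N | (#(nbrsIn G N u) : ℝ) ≤ d / s ^ 8}, d / s ^ 8 := by
                rw [sum_const, nsmul_eq_mul]
            _ ≤ ∑ u ∈ N \ {u ∈ N | (#(nbrsIn G N u) : ℝ) ≤ d / s ^ 8},
                  (#(nbrsIn G N u) : ℝ) := by
                refine sum_le_sum fun u hu => ?_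
                simp only [mem_sdiff, mem_filter, not_and, not_le] at hu
                exact (hu.2 hu.1).le
            _ ≤ ∑ u ∈ N, (#(nbrsIn G N u) : ℝ) :=
                sum_le_sum_of_subset_of_nonneg sdiff_subset fun _ _ _ => by positivity
            _ ≤ 2 * ({t : Finset V | v ∈ t ∧ G.IsNClique 3 t}.ncard : ℝ) := by
                exact_mod_cast sum_card_nbrsIn_le X v
            _ ≤ _ := by gcongr; exact htri v
        have h2 : 2 * (d ^ 2 / s ^ 16) = 2 * d / s ^ 8 * (d / s ^ 8) := by field_simp
        rw [h2] at h1
        have h3 := le_of_mul_le_mul_right h1 (by positivity)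
        rwa [le_div_iff₀ (by positivity)] at h3
      · rw [Fintype.card_fin]
        refine le_trans ?_ hexp
        have h1 : 2 * d / s ^ 8 ≤ 2 * d / s ^ 2 := by
          gcongr
          · linarith
          · norm_num
        have h2 : d * (d / s ^ 6 / (d / s ^ 2)) = d / s ^ 4 := by field_simp
        have h3 : d / s ^ 4 ≤ d / s ^ 2 := by
          gcongr
          · linarith
          · norm_num
        have h4 : 4 * d / s ^ 2 = d / s ^ 2 + 2 * d / s ^ 2 + d / s ^ 2 := by ring
        rw [h2, h4]
        linarith
  rw [← Fintype.card_fin k]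
  refine colorable_of_properOn_univ_nonempty ?_
  rw [← card_pos]
  induction (univ : Finset V) using Finset.induction_on with
  | empty => exact card_pos.2 ⟨fun _ => 0, by simp [mem_properOn]⟩
  | insert v X hv ih =>
    have h1 : (0 : ℝ) < #(properOn (Fin k) G X) := by exact_mod_cast ih
    have h2 := (mul_pos hl h1).trans_le (hgrow X v hv)
    exact_mod_cast pos_of_mul_pos_left h2 (Nat.cast_nonneg _)

end

end LocallySparse

/-- Alon–Krivelevich–Sudakov: there exist `C > 0` and `Δ₀` such
that for every `Δ ≥ Δ₀` and every real `2 ≤ f ≤ Δ²`: if `G` is a finite simple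
graph with maximum degree at most `Δ` in which every vertex lies in at most `Δ²/f`
triangles, then `χ(G) ≤ C Δ / log f`. -/
theorem statement_15 :
    ∃ C : ℝ, 0 < C ∧ ∃ Δ₀ : ℕ, ∀ (V : Type) [Fintype V] [DecidableEq V]
      (G : SimpleGraph V) [DecidableRel G.Adj] (Δ : ℕ) (f : ℝ),
      Δ₀ ≤ Δ → 2 ≤ f → f ≤ (Δ : ℝ) ^ 2 →
      (∀ v : V, G.degree v ≤ Δ) →
      (∀ u : V, ({t : Finset V | u ∈ t ∧ G.IsNClique 3 t}.ncard : ℝ) ≤ (Δ : ℝ) ^ 2 / f) →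
      ∃ n : ℕ, G.Colorable n ∧ (n : ℝ) ≤ C * (Δ : ℝ) / Real.log f := by
  refine ⟨66, by norm_num, 1, fun V _ _ G _ Δ f hΔ hf hfΔ hdeg htri => ?_⟩
  have hΔ1 : (1 : ℝ) ≤ Δ := by exact_mod_cast hΔ
  have hf0 : 0 < f := by linarith
  have hlogf : 0 < Real.log f := Real.log_pos (by linarith)
  rcases lt_or_ge f (2 ^ 16) with hsmall | hlarge
  · refine ⟨Δ + 1, LocallySparse.colorable_of_degree_lt fun v => Nat.lt_succ_of_le (hdeg v), ?_⟩
    have h1 : Real.log f ≤ 16 := by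
      have := Real.log_le_log hf0 hsmall.le
      rw [Real.log_pow] at this
      have h2 := Real.log_le_sub_one_of_pos (x := 2) (by norm_num)
      push_cast at this
      linarith
    rw [le_div_iff₀ hlogf]
    push_cast
    nlinarith
  · have hs : (f ^ (1 / 16 : ℝ)) ^ 16 = f := by
      rw [← Real.rpow_natCast, ← Real.rpow_mul hf0.le]
      norm_num
    set s : ℝ := f ^ (1 / 16 : ℝ) with hs_def
    have hs0 : 0 < s := Real.rpow_pos_of_pos hf0 _
    have hs2 : 2 ≤ s := by
      rw [← hs] at hlarge
      exact le_of_pow_le_pow_left₀ (by norm_num) hs0.le hlarge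
    have hsΔ : s ^ 8 ≤ Δ := by
      refine le_of_pow_le_pow_left₀ (n := 2) (by norm_num) (by positivity) ?_
      rw [← pow_mul]
      exact hs.trans_le hfΔ
    have hlogs : Real.log f = 16 * Real.log s := by
      rw [← hs, Real.log_pow]
      norm_num
    have hlogs0 : 0 < Real.log s := by linarith
    refine ⟨⌈4 * (Δ : ℝ) / Real.log s⌉₊, LocallySparse.colorable_of_locally_sparse hs2 hsΔ
      (fun v => by exact_mod_cast hdeg v) (fun v => by rw [hs]; exact htri v) (Nat.le_ceil _), ?_⟩
    have h1 := (Nat.ceil_lt_add_one (a := 4 * (Δ : ℝ) / Real.log s) (by positivity)).le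
    have h2 : 4 * (Δ : ℝ) / Real.log s = 64 * Δ / Real.log f := by
      rw [hlogs]
      field_simp
      norm_num
    have h3 : 1 ≤ 2 * (Δ : ℝ) / Real.log f := by
      rw [one_le_div hlogf]
      have h4 := Real.log_le_log hf0 hfΔ
      rw [Real.log_pow] at h4
      have h5 := Real.log_le_sub_one_of_pos (x := (Δ : ℝ)) (by linarith)
      push_cast at h4
      linarith
    have h6 : 66 * (Δ : ℝ) / Real.log f = 64 * Δ / Real.log f + 2 * Δ / Real.log f := by ring
    rw [h6]
    linarith
end
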